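/- Let W be an algebraic Weyl tensor on Euclidean ℝ⁴, not identically zero, with W(e₁,x,y,e₁) = 0 for all x,y ∈ ℝ⁴ (so that Ŵ_L commutes with J). Call P ∈ ℝ⁶ a spacelike critical plane if ⟨P,P⟩_L = 1, ⟨P,JP⟩_L = 0, and for every differentiable curve γ : ℝ → ℝ⁶ with γ(0) = P and ⟨γ(t),γ(t)⟩_L = 1 and ⟨γ(t),Jγ(t)⟩_L = 0 for all t, the function t ↦ ⟨Ŵ_L γ(t), γ(t)⟩_L has derivative 0 at t = 0. Then the set of spacelike critical planes either has exactly six elements (three planes counted with both signs ±P) or is infinite; moreover, it has exactly six elements if and only if the complex operator 𝒲 has three distinct eigenvalues (Petrov Type I), and it is infinite if and only if 𝒲 has exactly two distinct eigenvalues (Petrov Type D). -/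

import Mathlib

open scoped BigOperators

/-- Vectors in ℝ⁴. -/
abbrev V4 : Type := Fin 4 → ℝ

/-- ℝ⁶, identified with Λ²ℝ⁴ via the ordered basis
`e₁∧e₂, e₁∧e₃, e₁∧e₄, e₃∧e₄, e₄∧e₂, e₂∧e₃`. -/
abbrev V6 : Type := Fin 6 → ℝ

/-- Covariant 4-tensors (multilinear maps ℝ⁴×ℝ⁴×ℝ⁴×ℝ⁴ → ℝ). -/
abbrev Tensor4 : Type := MultilinearMap ℝ (fun _ : Fin 4 => V4) ℝ

/-- Evaluation of a 4-tensor on four vectors. -/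
def tapp (W : Tensor4) (x y z w : V4) : ℝ := W ![x, y, z, w]

/-- Standard basis of ℝ⁴ (0-indexed: `e 0 = e₁`, …, `e 3 = e₄`). -/
def e (i : Fin 4) : V4 := Pi.single i 1

/-- Standard basis of ℝ⁶ (0-indexed: `u 0 = u₁`, …, `u 5 = u₆`). -/
def u (c : Fin 6) : V6 := Pi.single c 1

/-- The index pairs of the six coordinate 2-planes
`e₁∧e₂, e₁∧e₃, e₁∧e₄, e₃∧e₄, e₄∧e₂, e₂∧e₃` (0-indexed). -/
def pairs : Fin 6 → Fin 4 × Fin 4 := ![(0,1), (0,2), (0,3), (2,3), (3,1), (1,2)]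

/-- The Minkowski inner product `η` on ℝ⁴ (timelike direction `e₁`). -/
def etaR4 (x y : V4) : ℝ := -(x 0 * y 0) + x 1 * y 1 + x 2 * y 2 + x 3 * y 3

/-- The Lorentzian inner product `⟨·,·⟩_L` on ℝ⁶, of signature (−−−+++). -/
def ipL (ξ η : V6) : ℝ :=
  -(ξ 0 * η 0) - ξ 1 * η 1 - ξ 2 * η 2 + ξ 3 * η 3 + ξ 4 * η 4 + ξ 5 * η 5

/-- The matrix of the Lorentzian Hodge star `J = [[0, I₃],[−I₃, 0]]`. -/
def Jmat : Matrix (Fin 6) (Fin 6) ℝ :=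
  !![0,0,0,1,0,0;
     0,0,0,0,1,0;
     0,0,0,0,0,1;
     -1,0,0,0,0,0;
     0,-1,0,0,0,0;
     0,0,-1,0,0,0]

/-- The Lorentzian Hodge star `J` as a linear map on ℝ⁶. -/
def J : V6 →ₗ[ℝ] V6 := Matrix.toLin' Jmat

/-- The matrix of the Riemannian Hodge star `S = [[0, I₃],[I₃, 0]]`. -/
def Smat : Matrix (Fin 6) (Fin 6) ℝ :=
  !![0,0,0,1,0,0;
     0,0,0,0,1,0;
     0,0,0,0,0,1;
     1,0,0,0,0,0;
     0,1,0,0,0,0;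
     0,0,1,0,0,0]

/-- The Riemannian Hodge star `S` as a linear map on ℝ⁶. -/
def S : V6 →ₗ[ℝ] V6 := Matrix.toLin' Smat

/-- `W` is an algebraic Weyl tensor on Euclidean ℝ⁴. -/
def IsWeylE (W : Tensor4) : Prop :=
  (∀ x y z w, tapp W x y z w = - tapp W y x z w) ∧
  (∀ x y z w, tapp W x y z w = - tapp W x y w z) ∧
  (∀ x y z w, tapp W x y z w = tapp W z w x y) ∧
  (∀ x y z w, tapp W x y z w + tapp W y z x w + tapp W z x y w = 0) ∧
  (∀ x y, ∑ i : Fin 4, tapp W (e i) x y (e i) = 0)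

/-- `W` is an algebraic Weyl tensor on Minkowski ℝ⁴ (η-trace-free). -/
def IsWeylM (W : Tensor4) : Prop :=
  (∀ x y z w, tapp W x y z w = - tapp W y x z w) ∧
  (∀ x y z w, tapp W x y z w = - tapp W x y w z) ∧
  (∀ x y z w, tapp W x y z w = tapp W z w x y) ∧
  (∀ x y z w, tapp W x y z w + tapp W y z x w + tapp W z x y w = 0) ∧
  (∀ x y, -(tapp W (e 0) x y (e 0)) + tapp W (e 1) x y (e 1)
      + tapp W (e 2) x y (e 2) + tapp W (e 3) x y (e 3) = 0)

/-- `WL` is the Lorentzian Weyl operator of `W`: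
`⟨WL u_c, u_r⟩_L = W(e_{i(c)}, e_{j(c)}, e_{i(r)}, e_{j(r)})`. -/
def IsLorentzWeylOp (W : Tensor4) (WL : V6 →ₗ[ℝ] V6) : Prop :=
  ∀ c r : Fin 6,
    ipL (WL (u c)) (u r) =
      tapp W (e (pairs c).1) (e (pairs c).2) (e (pairs r).1) (e (pairs r).2)

/-- `Wg` is the Riemannian Weyl operator of `W`:
`⟨Wg u_c, u_r⟩ = W(e_{i(c)}, e_{j(c)}, e_{i(r)}, e_{j(r)})` w.r.t. the dot product. -/
def IsRiemWeylOp (W : Tensor4) (Wg : V6 →ₗ[ℝ] V6) : Prop :=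
  ∀ c r : Fin 6,
    (∑ i : Fin 6, Wg (u c) i * u r i) =
      tapp W (e (pairs c).1) (e (pairs c).2) (e (pairs r).1) (e (pairs r).2)

/-- `ξ` is an eigenvector of the complex-linear operator `𝒲` induced by `WL` on
`(ℝ⁶, i := J)`, with complex eigenvalue `a + bi`. -/
def IsCEigen (WL : V6 →ₗ[ℝ] V6) (a b : ℝ) (ξ : V6) : Prop :=
  ξ ≠ 0 ∧ WL ξ = a • ξ + b • J ξ

/-- The set of complex eigenvalues of `𝒲`, recorded as pairs `(a, b) ∈ ℝ × ℝ`
standing for `a + bi`. -/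
def cSpectrum (WL : V6 →ₗ[ℝ] V6) : Set (ℝ × ℝ) :=
  {z | ∃ ξ : V6, IsCEigen WL z.1 z.2 ξ}

/-- `𝒲` is diagonalizable: there is a complex basis `ξ₁, ξ₂, ξ₃` of `(ℝ⁶, i := J)`
consisting of eigenvectors, i.e. `ξ₁, Jξ₁, ξ₂, Jξ₂, ξ₃, Jξ₃` is a real basis of ℝ⁶. -/
def HasEigenBasis (WL : V6 →ₗ[ℝ] V6) : Prop :=
  ∃ (a b : Fin 3 → ℝ) (ξ : Fin 3 → V6),
    (∀ i, IsCEigen WL (a i) (b i) (ξ i)) ∧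
    LinearIndependent ℝ ![ξ 0, J (ξ 0), ξ 1, J (ξ 1), ξ 2, J (ξ 2)] ∧
    Submodule.span ℝ (Set.range ![ξ 0, J (ξ 0), ξ 1, J (ξ 1), ξ 2, J (ξ 2)]) = ⊤

/-- `P` is a spacelike critical plane of the `g_L`-quadratic form of `W`:
`P` is a spacelike 2-plane (`⟨P,P⟩_L = 1`, `⟨P,JP⟩_L = 0`) and the quadratic form
`ξ ↦ ⟨Ŵ_L ξ, ξ⟩_L` has vanishing derivative at `P` along every differentiable
curve through `P` in the set of spacelike 2-planes. -/
def IsSpacelikeCritical (WL : V6 →ₗ[ℝ] V6) (P : V6) : Prop :=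
  ipL P P = 1 ∧ ipL P (J P) = 0 ∧
  ∀ γ : ℝ → V6, Differentiable ℝ γ → γ 0 = P →
    (∀ t, ipL (γ t) (γ t) = 1) → (∀ t, ipL (γ t) (J (γ t)) = 0) →
    deriv (fun t => ipL (WL (γ t)) (γ t)) 0 = 0

/-- The timelike part (the first three coordinates) of a bivector. -/
def tl (P : V6) : Fin 3 → ℝ := ![P 0, P 1, P 2]

/-- The spacelike part (the last three coordinates) of a bivector. -/
def sl (P : V6) : Fin 3 → ℝ := ![P 3, P 4, P 5]

/-- The bivector with prescribed timelike and spacelike parts. -/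
def join (x y : Fin 3 → ℝ) : V6 := ![x 0, x 1, x 2, y 0, y 1, y 2]

@[simp] lemma tl_join (x y : Fin 3 → ℝ) : tl (join x y) = x := by
  ext i; fin_cases i <;> rfl

@[simp] lemma sl_join (x y : Fin 3 → ℝ) : sl (join x y) = y := by
  ext i; fin_cases i <;> rfl

lemma bivector_ext {P Q : V6} (ht : tl P = tl Q) (hs : sl P = sl Q) : P = Q := by
  ext i
  fin_cases i
  exacts [congrFun ht 0, congrFun ht 1, congrFun ht 2,
    congrFun hs 0, congrFun hs 1, congrFun hs 2]

@[simp] lemma tl_add (P Q : V6) : tl (P + Q) = tl P + tl Q := by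
  ext i; fin_cases i <;> rfl

@[simp] lemma sl_add (P Q : V6) : sl (P + Q) = sl P + sl Q := by
  ext i; fin_cases i <;> rfl

@[simp] lemma tl_smul (a : ℝ) (P : V6) : tl (a • P) = a • tl P := by
  ext i; fin_cases i <;> rfl

@[simp] lemma sl_smul (a : ℝ) (P : V6) : sl (a • P) = a • sl P := by
  ext i; fin_cases i <;> rfl

@[simp] lemma tl_zero : tl 0 = 0 := by
  ext i; fin_cases i <;> rfl

@[simp] lemma sl_zero : sl 0 = 0 := by
  ext i; fin_cases i <;> rfl

@[simp] lemma tl_J (P : V6) : tl (J P) = sl P := by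
  ext i
  fin_cases i <;>
    simp [tl, sl, J, Jmat, Matrix.toLin'_apply, Matrix.mulVec, dotProduct, Fin.sum_univ_six]

@[simp] lemma sl_J (P : V6) : sl (J P) = -tl P := by
  ext i
  fin_cases i <;>
    simp [tl, sl, J, Jmat, Matrix.toLin'_apply, Matrix.mulVec, dotProduct, Fin.sum_univ_six]

lemma ipL_eq (P Q : V6) : ipL P Q = -(tl P ⬝ᵥ tl Q) + sl P ⬝ᵥ sl Q := by
  simp only [ipL, tl, sl, dotProduct, Fin.sum_univ_three, Matrix.cons_val]
  ring

lemma ipL_comm (P Q : V6) : ipL P Q = ipL Q P := by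
  simp only [ipL]; ring

/-- `WL` has the block form `[[0, -B], [B, 0]]`. -/
def HasBlockForm (WL : V6 →ₗ[ℝ] V6) (B : Matrix (Fin 3) (Fin 3) ℝ) : Prop :=
  ∀ P, tl (WL P) = -(B.mulVec (sl P)) ∧ sl (WL P) = B.mulVec (tl P)

lemma eq_zero_of_pairs (R : Fin 4 → Fin 4 → ℝ) (hR : ∀ i j, R i j = -R j i)
    (h : ∀ c, R (pairs c).1 (pairs c).2 = 0) (i j : Fin 4) : R i j = 0 := by
  have h0 := h 0
  have h1 := h 1
  have h2 := h 2
  have h3 := h 3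
  have h4 := h 4
  have h5 := h 5
  simp only [pairs, Matrix.cons_val] at h0 h1 h2 h3 h4 h5
  have hij := hR i j
  fin_cases i <;> fin_cases j <;> simp only [Fin.zero_eta, Fin.mk_one, Fin.reduceFinMk] at * <;>
    linarith

lemma tensor_eq_zero {W : Tensor4} (hW : IsWeylE W)
    (h : ∀ c r : Fin 6,
      tapp W (e (pairs c).1) (e (pairs c).2) (e (pairs r).1) (e (pairs r).2) = 0) : W = 0 := by
  obtain ⟨h12, h34, -⟩ := hW
  have key : ∀ i j k l : Fin 4, tapp W (e i) (e j) (e k) (e l) = 0 := fun i j k l =>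
    eq_zero_of_pairs (fun i j => tapp W (e i) (e j) (e k) (e l)) (fun _ _ => h12 _ _ _ _)
      (fun c => eq_zero_of_pairs (fun k l => tapp W (e (pairs c).1) (e (pairs c).2) (e k) (e l))
        (fun _ _ => h34 _ _ _ _) (fun r => h c r) k l) i j
  refine Module.Basis.ext_multilinear (fun _ => Pi.basisFun ℝ (Fin 4)) fun v => ?_
  have hv := key (v 0) (v 1) (v 2) (v 3)
  have hfun : (fun i => Pi.basisFun ℝ (Fin 4) (v i)) = ![e (v 0), e (v 1), e (v 2), e (v 3)] := by
    funext i
    fin_cases i <;> simp [e]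
  rw [hfun]
  exact hv

lemma weyl_components {R : Fin 4 → Fin 4 → Fin 4 → Fin 4 → ℝ}
    (h12 : ∀ i j k l, R i j k l = -R j i k l) (h34 : ∀ i j k l, R i j k l = -R i j l k)
    (hpair : ∀ i j k l, R i j k l = R k l i j)
    (hbianchi : ∀ i j k l, R i j k l + R j k i l + R k i j l = 0)
    (hric : ∀ j k, R 0 j k 0 + R 1 j k 1 + R 2 j k 2 + R 3 j k 3 = 0)
    (hT : ∀ j k, R 0 j k 0 = 0) :
    (∀ j k, R 0 j 0 k = 0) ∧ R 2 3 2 3 = 0 ∧ R 3 1 3 1 = 0 ∧ R 1 2 1 2 = 0 ∧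
      R 2 3 3 1 = 0 ∧ R 2 3 1 2 = 0 ∧ R 3 1 1 2 = 0 ∧
      R 0 1 3 1 = R 0 2 2 3 ∧ R 0 1 1 2 = R 0 3 2 3 ∧ R 0 2 1 2 = R 0 3 3 1 ∧
      R 0 1 2 3 + R 0 2 3 1 + R 0 3 1 2 = 0 := by
  have hz : ∀ i k l, R i i k l = 0 := fun i k l => by linarith [h12 i i k l]
  have hz' : ∀ i j k, R i j k k = 0 := fun i j k => by linarith [h34 i j k k]
  have h11 := hric 1 1
  have h22 := hric 2 2
  have h33 := hric 3 3
  have e21 : R 2 1 1 2 = -R 1 2 1 2 := h12 _ _ _ _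
  have e31 : R 3 1 1 3 = -R 3 1 3 1 := h34 _ _ _ _
  have e12 : R 1 2 2 1 = -R 1 2 1 2 := h34 _ _ _ _
  have e32 : R 3 2 2 3 = -R 2 3 2 3 := h12 _ _ _ _
  have e13 : R 1 3 3 1 = -R 3 1 3 1 := h12 _ _ _ _
  have e23 : R 2 3 3 2 = -R 2 3 2 3 := h34 _ _ _ _
  simp only [hT, hz, e21, e31, e12, e32, e13, e23] at h11 h22 h33
  refine ⟨fun j k => by linarith [h34 0 j 0 k, hT j k], by linarith, by linarith, by linarith,
    ?_, ?_, ?_, ?_, ?_, ?_, ?_⟩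
  · linarith [hric 2 1, hT 2 1, hz 1 2 1, hz 2 1 2, h12 3 2 1 3, h34 2 3 1 3, hz' 2 2 1,
      hz' 1 2 1]
  · linarith [hric 3 1, hT 3 1, hz 2 1 2, hz 3 1 3, hz' 1 3 1, h34 2 3 1 2, hz 1 3 1]
  · linarith [hric 3 2, hT 3 2, h12 1 3 2 1, h34 3 1 2 1, hz' 2 3 2, hz 3 2 3]
  · linarith [hric 0 3, hT 0 3, hz' 3 0 3, h12 1 0 3 1, h12 2 0 3 2, h34 0 2 3 2]
  · linarith [hric 0 2, hT 0 2, hz' 2 0 2, h12 1 0 2 1, h12 3 0 2 3, h34 0 1 2 1]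
  · linarith [hric 0 1, hT 0 1, hz' 1 0 1, h12 2 0 1 2, h12 3 0 1 3, h34 0 3 1 3]
  · linarith [hbianchi 0 1 2 3, hpair 1 2 0 3, h12 2 0 1 3, h34 0 2 1 3]

lemma linearMap_apply_eq_sum (L : V6 →ₗ[ℝ] V6) (P : V6) (r : Fin 6) :
    L P r = ∑ c, P c * L (u c) r := by
  conv_lhs => rw [pi_eq_sum_univ' P, map_sum, Finset.sum_apply]
  refine Finset.sum_congr rfl fun c _ => ?_
  rw [map_smul, Pi.smul_apply, smul_eq_mul]
  congr 3

lemma exists_blockForm {W : Tensor4} {WL : V6 →ₗ[ℝ] V6}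
    (hW : IsWeylE W) (hne : W ≠ 0) (hWL : IsLorentzWeylOp W WL)
    (hT : ∀ x y : V4, tapp W (e 0) x y (e 0) = 0) :
    ∃ B : Matrix (Fin 3) (Fin 3) ℝ,
      B.IsHermitian ∧ B.trace = 0 ∧ B ≠ 0 ∧ HasBlockForm WL B := by
  have hW0 := mt (tensor_eq_zero hW) hne
  obtain ⟨h12, h34, hpair, hbianchi, hric⟩ := hW
  obtain ⟨R, hR⟩ : ∃ R : Fin 4 → Fin 4 → Fin 4 → Fin 4 → ℝ,
    ∀ i j k l, tapp W (e i) (e j) (e k) (e l) = R i j k l := ⟨_, fun _ _ _ _ => rfl⟩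
  have hp : ∀ i j k l, R i j k l = R k l i j := fun i j k l => by
    simpa only [hR] using hpair (e i) (e j) (e k) (e l)
  obtain ⟨hA, h33, h44, h55, h34, h35, h45, s1, s2, s3, htr⟩ := weyl_components (R := R)
    (fun i j k l => by simpa only [hR] using h12 (e i) (e j) (e k) (e l))
    (fun i j k l => by simpa only [hR] using h34 (e i) (e j) (e k) (e l)) hp
    (fun i j k l => by simpa only [hR] using hbianchi (e i) (e j) (e k) (e l))
    (fun j k => by simpa only [hR, Fin.sum_univ_four] using hric (e j) (e k))
    (fun j k => by simpa only [hR] using hT (e j) (e k))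
  have h43 := (hp 3 1 2 3).trans h34
  have h53 := (hp 1 2 2 3).trans h35
  have h54 := (hp 1 2 3 1).trans h45
  simp only [IsLorentzWeylOp, hR] at hWL
  simp only [hR] at hW0
  have hneg : ∀ c, WL (u c) 0 = -R (pairs c).1 (pairs c).2 0 1 ∧
      WL (u c) 1 = -R (pairs c).1 (pairs c).2 0 2 ∧
      WL (u c) 2 = -R (pairs c).1 (pairs c).2 0 3 := fun c =>
    ⟨by simpa [ipL, u, pairs, Pi.single_apply] using congrArg Neg.neg (hWL c 0),
     by simpa [ipL, u, pairs, Pi.single_apply] using congrArg Neg.neg (hWL c 1),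
     by simpa [ipL, u, pairs, Pi.single_apply] using congrArg Neg.neg (hWL c 2)⟩
  have hpos : ∀ c, WL (u c) 3 = R (pairs c).1 (pairs c).2 2 3 ∧
      WL (u c) 4 = R (pairs c).1 (pairs c).2 3 1 ∧
      WL (u c) 5 = R (pairs c).1 (pairs c).2 1 2 := fun c =>
    ⟨by simpa [ipL, u, pairs, Pi.single_apply] using hWL c 3,
     by simpa [ipL, u, pairs, Pi.single_apply] using hWL c 4,
     by simpa [ipL, u, pairs, Pi.single_apply] using hWL c 5⟩
  refine ⟨!![R 0 1 2 3, R 0 1 3 1, R 0 1 1 2;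
             R 0 1 3 1, R 0 2 3 1, R 0 2 1 2;
             R 0 1 1 2, R 0 2 1 2, R 0 3 1 2], ?_, ?_, ?_, ?_⟩
  · ext i j
    fin_cases i <;> fin_cases j <;> simp
  · simpa [Matrix.trace_fin_three] using htr
  · intro hB
    refine hW0 fun c r => ?_
    have hB' := fun i j => congrFun (congrFun hB i) j
    have b00 := hB' 0 0
    have b01 := hB' 0 1
    have b02 := hB' 0 2
    have b11 := hB' 1 1
    have b12 := hB' 1 2
    have b22 := hB' 2 2
    simp at b00 b01 b02 b11 b12 b22
    fin_cases c <;> fin_cases r <;>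
      simp [pairs, hp 2 3 0, hp 3 1 0, hp 1 2 0, hA, h33, h44, h55, h34, h35, h45, h43, h53, h54,
        ← s1, ← s2, ← s3, b00, b01, b02, b11, b12, b22]
  · intro P
    constructor <;> ext i <;> fin_cases i <;>
      simp [tl, sl, linearMap_apply_eq_sum WL P, Fin.sum_univ_six, Matrix.mulVec, dotProduct,
        Fin.sum_univ_three, hneg, hpos, pairs, hp 2 3 0, hp 3 1 0, hp 1 2 0, hA, h33, h44, h55,
        h34, h35, h45, h43, h53, h54, ← s1, ← s2, ← s3] <;> ring

lemma hasDerivAt_ipL (L : V6 →ₗ[ℝ] V6) {γ : ℝ → V6} {γ' : V6} {t : ℝ}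
    (h : HasDerivAt γ γ' t) :
    HasDerivAt (fun s => ipL (L (γ s)) (γ s)) (ipL (L γ') (γ t) + ipL (L (γ t)) γ') t := by
  have hL : HasDerivAt (fun s => L (γ s)) (L γ') t :=
    L.toContinuousLinearMap.hasFDerivAt.comp_hasDerivAt t h
  rw [hasDerivAt_pi] at h hL
  have hp := fun i => (hL i).mul (h i)
  have := ((((((hp 0).neg.sub (hp 1)).sub (hp 2)).add (hp 3)).add (hp 4)).add (hp 5))
  refine HasDerivAt.congr_deriv this ?_
  simp only [ipL]
  ring

lemma dot_mulVec_comm {B : Matrix (Fin 3) (Fin 3) ℝ} (hB : B.IsHermitian) (x y : Fin 3 → ℝ) :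
    x ⬝ᵥ B.mulVec y = y ⬝ᵥ B.mulVec x := by
  have hB' : B.transpose = B := by simpa using hB.eq
  rw [Matrix.dotProduct_mulVec, ← Matrix.mulVec_transpose, hB', dotProduct_comm]

lemma ipL_blockForm_symm {WL : V6 →ₗ[ℝ] V6} {B : Matrix (Fin 3) (Fin 3) ℝ}
    (hB : B.IsHermitian) (hWL : HasBlockForm WL B) (P Q : V6) :
    ipL (WL P) Q = ipL (WL Q) P := by
  rw [ipL_eq, ipL_eq, (hWL P).1, (hWL P).2, (hWL Q).1, (hWL Q).2]
  simp only [neg_dotProduct, neg_neg]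
  rw [dotProduct_comm _ (tl Q), dotProduct_comm _ (tl P), dotProduct_comm _ (sl Q),
    dotProduct_comm _ (sl P), dot_mulVec_comm hB (tl Q), dot_mulVec_comm hB (tl P), add_comm]

/-- A curve `P + (c - 1) Q + s R` of spacelike planes, with `c, s` having derivatives `0, 1` at `0`,
tests criticality in the direction `R`. -/
lemma IsSpacelikeCritical.ipL_eq_zero {WL : V6 →ₗ[ℝ] V6} {P : V6} (hP : IsSpacelikeCritical WL P)
    (hsymm : ∀ P Q, ipL (WL P) Q = ipL (WL Q) P) (Q R : V6) (c s : ℝ → ℝ)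
    (hc : Differentiable ℝ c) (hs : Differentiable ℝ s) (hc0 : c 0 = 1) (hs0 : s 0 = 0)
    (hc' : HasDerivAt c 0 0) (hs' : HasDerivAt s 1 0)
    (h1 : ∀ t, ipL (P + (c t - 1) • Q + s t • R) (P + (c t - 1) • Q + s t • R) = 1)
    (h2 : ∀ t, ipL (P + (c t - 1) • Q + s t • R) (J (P + (c t - 1) • Q + s t • R)) = 0) :
    ipL (WL P) R = 0 := by
  have hd : HasDerivAt (fun t => P + (c t - 1) • Q + s t • R) R 0 := by
    have := (((hc'.sub_const 1).smul_const Q).const_add P).add (hs'.smul_const R)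
    simpa [Pi.add_def] using this
  have h := hP.2.2 (fun t => P + (c t - 1) • Q + s t • R) (by fun_prop) (by simp [hc0, hs0]) h1 h2
  rw [(hasDerivAt_ipL WL hd).deriv] at h
  simp only [hc0, hs0, sub_self, zero_smul, add_zero] at h
  rw [hsymm R P] at h
  linarith

/-- The rotation generator about the `k`-th axis. -/
def rot (k : Fin 3) (x : Fin 3 → ℝ) : Fin 3 → ℝ :=
  ![![0, -x 2, x 1], ![x 2, 0, -x 0], ![-x 1, x 0, 0]] k

lemma IsSpacelikeCritical.rotation {WL : V6 →ₗ[ℝ] V6} {P : V6} (hP : IsSpacelikeCritical WL P)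
    (hsymm : ∀ P Q, ipL (WL P) Q = ipL (WL Q) P) (k : Fin 3) :
    ipL (WL P) (join (rot k (tl P)) (rot k (sl P))) = 0 := by
  have e1 := hP.1
  have e2 := hP.2.1
  rw [ipL_eq] at e1 e2
  simp only [tl_J, sl_J, dotProduct_neg] at e2
  have hcs : ∀ t, Real.cos t ^ 2 + Real.sin t ^ 2 = 1 := Real.cos_sq_add_sin_sq
  refine hP.ipL_eq_zero hsymm
    (join (-rot k (rot k (tl P))) (-rot k (rot k (sl P)))) _ Real.cos Real.sin
    Real.differentiable_cos Real.differentiable_sin Real.cos_zero Real.sin_zero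
    (by simpa using Real.hasDerivAt_cos 0) (by simpa using Real.hasDerivAt_sin 0) ?_ ?_
  · intro t
    rw [ipL_eq]
    simp only [tl_add, sl_add, tl_smul, sl_smul, tl_join, sl_join]
    generalize tl P = x, sl P = y at *
    have h := hcs t
    generalize Real.cos t = c, Real.sin t = s at *
    simp only [dotProduct, Fin.sum_univ_three] at e1 ⊢
    fin_cases k <;>
      simp only [rot, Fin.zero_eta, Fin.mk_one, Fin.reduceFinMk, Matrix.cons_val, Pi.add_apply,
        Pi.smul_apply, Pi.neg_apply, smul_eq_mul]
    · linear_combination e1 + h * (-(x 1 ^ 2 + x 2 ^ 2) + (y 1 ^ 2 + y 2 ^ 2))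
    · linear_combination e1 + h * (-(x 0 ^ 2 + x 2 ^ 2) + (y 0 ^ 2 + y 2 ^ 2))
    · linear_combination e1 + h * (-(x 0 ^ 2 + x 1 ^ 2) + (y 0 ^ 2 + y 1 ^ 2))
  · intro t
    rw [ipL_eq]
    simp only [tl_J, sl_J, tl_add, sl_add, tl_smul, sl_smul, tl_join, sl_join]
    generalize tl P = x, sl P = y at *
    have h := hcs t
    generalize Real.cos t = c, Real.sin t = s at *
    simp only [dotProduct, Fin.sum_univ_three] at e2 ⊢
    fin_cases k <;>
      simp only [rot, Fin.zero_eta, Fin.mk_one, Fin.reduceFinMk, Matrix.cons_val, Pi.add_apply,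
        Pi.smul_apply, Pi.neg_apply, smul_eq_mul]
    · linear_combination e2 - 2 * h * (x 1 * y 1 + x 2 * y 2)
    · linear_combination e2 - 2 * h * (x 0 * y 0 + x 2 * y 2)
    · linear_combination e2 - 2 * h * (x 0 * y 0 + x 1 * y 1)

lemma IsSpacelikeCritical.boost {WL : V6 →ₗ[ℝ] V6} {P : V6} (hP : IsSpacelikeCritical WL P)
    (hsymm : ∀ P Q, ipL (WL P) Q = ipL (WL Q) P) (k : Fin 3) :
    ipL (WL P) (join (rot k (sl P)) (-rot k (tl P))) = 0 := by
  have e1 := hP.1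
  have e2 := hP.2.1
  rw [ipL_eq] at e1 e2
  simp only [tl_J, sl_J, dotProduct_neg] at e2
  have hcs : ∀ t, Real.cosh t ^ 2 - Real.sinh t ^ 2 = 1 := Real.cosh_sq_sub_sinh_sq
  refine hP.ipL_eq_zero hsymm
    (join (-rot k (rot k (tl P))) (-rot k (rot k (sl P)))) _ Real.cosh Real.sinh
    Real.differentiable_cosh Real.differentiable_sinh Real.cosh_zero Real.sinh_zero
    (by simpa using Real.hasDerivAt_cosh 0) (by simpa using Real.hasDerivAt_sinh 0) ?_ ?_
  · intro t
    rw [ipL_eq]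
    simp only [tl_add, sl_add, tl_smul, sl_smul, tl_join, sl_join]
    generalize tl P = x, sl P = y at *
    have h := hcs t
    generalize Real.cosh t = c, Real.sinh t = s at *
    simp only [dotProduct, Fin.sum_univ_three] at e1 ⊢
    fin_cases k <;>
      simp only [rot, Fin.zero_eta, Fin.mk_one, Fin.reduceFinMk, Matrix.cons_val, Pi.add_apply,
        Pi.smul_apply, Pi.neg_apply, smul_eq_mul]
    · linear_combination e1 + h * (-(x 1 ^ 2 + x 2 ^ 2) + (y 1 ^ 2 + y 2 ^ 2))
    · linear_combination e1 + h * (-(x 0 ^ 2 + x 2 ^ 2) + (y 0 ^ 2 + y 2 ^ 2))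
    · linear_combination e1 + h * (-(x 0 ^ 2 + x 1 ^ 2) + (y 0 ^ 2 + y 1 ^ 2))
  · intro t
    rw [ipL_eq]
    simp only [tl_J, sl_J, tl_add, sl_add, tl_smul, sl_smul, tl_join, sl_join]
    generalize tl P = x, sl P = y at *
    have h := hcs t
    generalize Real.cosh t = c, Real.sinh t = s at *
    simp only [dotProduct, Fin.sum_univ_three] at e2 ⊢
    fin_cases k <;>
      simp only [rot, Fin.zero_eta, Fin.mk_one, Fin.reduceFinMk, Matrix.cons_val, Pi.add_apply,
        Pi.smul_apply, Pi.neg_apply, smul_eq_mul]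
    · linear_combination e2 - 2 * h * (x 1 * y 1 + x 2 * y 2)
    · linear_combination e2 - 2 * h * (x 0 * y 0 + x 2 * y 2)
    · linear_combination e2 - 2 * h * (x 0 * y 0 + x 1 * y 1)

/-- The real form of: if `z × Bz = 0` and `z · z = -1`, where `z = x - i y`, `p = B x`, `q = B y`,
then `B z` is the multiple `-(z · B z) z` of `z`. -/
lemma parallel_of_cross_eq_zero {x y p q : Fin 3 → ℝ}
    (h1 : -(x ⬝ᵥ x) + y ⬝ᵥ y = 1) (h2 : x ⬝ᵥ y = 0)
    (hrot : ∀ k, q ⬝ᵥ rot k x + p ⬝ᵥ rot k y = 0)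
    (hboost : ∀ k, q ⬝ᵥ rot k y - p ⬝ᵥ rot k x = 0) :
    p = (y ⬝ᵥ q - x ⬝ᵥ p) • x + (x ⬝ᵥ q + y ⬝ᵥ p) • y ∧
      q = (y ⬝ᵥ q - x ⬝ᵥ p) • y - (x ⬝ᵥ q + y ⬝ᵥ p) • x := by
  have r0 := hrot 0
  have r1 := hrot 1
  have r2 := hrot 2
  have b0 := hboost 0
  have b1 := hboost 1
  have b2 := hboost 2
  simp only [rot, dotProduct, Fin.sum_univ_three, Matrix.cons_val] at r0 r1 r2 b0 b1 b2 h1 h2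
  constructor
  · ext i
    fin_cases i <;>
      simp only [dotProduct, Fin.sum_univ_three, Fin.zero_eta, Fin.mk_one, Fin.reduceFinMk,
        Pi.add_apply, Pi.smul_apply, smul_eq_mul]
    · linear_combination -(x 1 * b2 - x 2 * b1) - (y 1 * r2 - y 2 * r1) - p 0 * h1 - 2 * q 0 * h2
    · linear_combination -(x 2 * b0 - x 0 * b2) - (y 2 * r0 - y 0 * r2) - p 1 * h1 - 2 * q 1 * h2
    · linear_combination -(x 0 * b1 - x 1 * b0) - (y 0 * r1 - y 1 * r0) - p 2 * h1 - 2 * q 2 * h2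
  · ext i
    fin_cases i <;>
      simp only [dotProduct, Fin.sum_univ_three, Fin.zero_eta, Fin.mk_one, Fin.reduceFinMk,
        Pi.sub_apply, Pi.smul_apply, smul_eq_mul]
    · linear_combination (x 1 * r2 - x 2 * r1) - (y 1 * b2 - y 2 * b1) - q 0 * h1 + 2 * p 0 * h2
    · linear_combination (x 2 * r0 - x 0 * r2) - (y 2 * b0 - y 0 * b2) - q 1 * h1 + 2 * p 1 * h2
    · linear_combination (x 0 * r1 - x 1 * r0) - (y 0 * b1 - y 1 * b0) - q 2 * h1 + 2 * p 2 * h2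

lemma isSpacelikeCritical_iff {WL : V6 →ₗ[ℝ] V6} {B : Matrix (Fin 3) (Fin 3) ℝ}
    (hB : B.IsHermitian) (hWL : HasBlockForm WL B) (P : V6) :
    IsSpacelikeCritical WL P ↔
      -(tl P ⬝ᵥ tl P) + sl P ⬝ᵥ sl P = 1 ∧ tl P ⬝ᵥ sl P = 0 ∧
        ∃ μ : ℝ, B.mulVec (tl P) = μ • tl P ∧ B.mulVec (sl P) = μ • sl P := by
  have hsymm := ipL_blockForm_symm hB hWL
  have hJ : ∀ Q, ipL Q (J Q) = -2 * (tl Q ⬝ᵥ sl Q) := fun Q => by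
    rw [ipL_eq, tl_J, sl_J, dotProduct_neg, dotProduct_comm (sl Q)]
    ring
  constructor
  · intro hP
    have h1 := hP.1
    have h2 := hP.2.1
    rw [ipL_eq] at h1
    rw [hJ] at h2
    have h2' : tl P ⬝ᵥ sl P = 0 := by linarith
    refine ⟨h1, h2', ?_⟩
    obtain ⟨hp, hq⟩ := parallel_of_cross_eq_zero (p := B.mulVec (tl P)) (q := B.mulVec (sl P)) h1 h2'
      (fun k => by
        have := hP.rotation hsymm k
        rw [ipL_eq, (hWL P).1, (hWL P).2, tl_join, sl_join, neg_dotProduct] at this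
        linarith)
      (fun k => by
        have := hP.boost hsymm k
        rw [ipL_eq, (hWL P).1, (hWL P).2, tl_join, sl_join, neg_dotProduct, dotProduct_neg] at this
        linarith)
    set α := sl P ⬝ᵥ B.mulVec (sl P) - tl P ⬝ᵥ B.mulVec (tl P)
    set β := tl P ⬝ᵥ B.mulVec (sl P) + sl P ⬝ᵥ B.mulVec (tl P)
    have hβ : β = 0 := by
      have h := dot_mulVec_comm hB (tl P) (sl P)
      rw [hp, hq] at h
      simp only [dotProduct_sub, dotProduct_add, dotProduct_smul, smul_eq_mul, h2',
        dotProduct_comm (sl P) (tl P)] at h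
      have hx : 0 ≤ tl P ⬝ᵥ tl P := by
        simpa using dotProduct_star_self_nonneg (tl P)
      have : β * (1 + 2 * (tl P ⬝ᵥ tl P)) = 0 := by linear_combination -h - β * h1
      rcases mul_eq_zero.mp this with h | h
      · exact h
      · linarith
    exact ⟨α, by simpa [hβ] using hp, by simpa [hβ] using hq⟩
  · rintro ⟨h1, h2, μ, hx, hy⟩
    refine ⟨by rw [ipL_eq, h1], by rw [hJ, h2, mul_zero], fun γ hγ hγ0 _ hγ2 => ?_⟩
    have hd := (hγ 0).hasDerivAt
    set R := deriv γ 0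
    have hJd := hasDerivAt_ipL J hd
    have hzero : (fun s => ipL (J (γ s)) (γ s)) = fun _ => 0 := by
      funext s
      rw [ipL_comm, hγ2]
    rw [hzero] at hJd
    have hJ0 := hJd.unique (hasDerivAt_const (0 : ℝ) (0 : ℝ))
    rw [(hasDerivAt_ipL WL hd).deriv, hsymm R, hγ0]
    rw [hγ0] at hJ0
    rw [ipL_eq, ipL_eq, tl_J, sl_J, tl_J, sl_J, neg_dotProduct, neg_dotProduct,
      dotProduct_comm (sl R), dotProduct_comm (tl R)] at hJ0
    rw [ipL_eq, (hWL P).1, (hWL P).2, hx, hy, neg_dotProduct, smul_dotProduct, smul_dotProduct,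
      smul_eq_mul, smul_eq_mul]
    linear_combination -μ * hJ0

lemma mem_cSpectrum_iff {WL : V6 →ₗ[ℝ] V6} {B : Matrix (Fin 3) (Fin 3) ℝ}
    (hB : B.IsHermitian) (hWL : HasBlockForm WL B) (a b : ℝ) :
    (a, b) ∈ cSpectrum WL ↔ a = 0 ∧ ∃ x : Fin 3 → ℝ, x ≠ 0 ∧ B.mulVec x = (-b) • x := by
  constructor
  · rintro ⟨P, hP0, hP⟩
    have hx := (hWL P).2
    have hy := (hWL P).1
    rw [hP] at hx hy
    simp only [tl_add, sl_add, tl_smul, sl_smul, tl_J, sl_J] at hx hy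
    have hy' : B.mulVec (sl P) = -(a • tl P + b • sl P) := by rw [hy, neg_neg]
    have h := dot_mulVec_comm hB (tl P) (sl P)
    rw [hy', ← hx] at h
    simp only [dotProduct_neg, dotProduct_add, dotProduct_smul, smul_eq_mul,
      dotProduct_comm (sl P) (tl P), smul_neg] at h
    have hxx : 0 ≤ tl P ⬝ᵥ tl P := by
      simpa using dotProduct_star_self_nonneg (tl P)
    have hyy : 0 ≤ sl P ⬝ᵥ sl P := by
      simpa using dotProduct_star_self_nonneg (sl P)
    have hprod : a * (tl P ⬝ᵥ tl P + sl P ⬝ᵥ sl P) = 0 := by linear_combination -h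
    have hor : tl P ≠ 0 ∨ sl P ≠ 0 := by
      by_contra! hc
      exact hP0 (bivector_ext (by simpa using hc.1) (by simpa using hc.2))
    have ha : a = 0 := by
      rcases mul_eq_zero.mp hprod with h | h
      · exact h
      · rcases hor with h' | h'
        · exact absurd (dotProduct_self_eq_zero.mp (by linarith)) h'
        · exact absurd (dotProduct_self_eq_zero.mp (by linarith)) h'
    subst ha
    refine ⟨rfl, ?_⟩
    rcases hor with h' | h'
    · exact ⟨_, h', by rw [← hx]; simp⟩
    · exact ⟨_, h', by rw [hy']; simp⟩
  · rintro ⟨rfl, x, hx0, hx⟩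
    refine ⟨join 0 x, fun h => hx0 ?_, bivector_ext ?_ ?_⟩
    · simpa using congrArg sl h
    · simp [(hWL _).1, hx]
    · simp [(hWL _).2]

lemma exists_eigenbasis {B : Matrix (Fin 3) (Fin 3) ℝ} (hB : B.IsHermitian) (htr : B.trace = 0)
    (hB0 : B ≠ 0) :
    ∃ (v : Fin 3 → Fin 3 → ℝ) (μ : Fin 3 → ℝ),
      (∀ i j, v i ⬝ᵥ v j = if i = j then 1 else 0) ∧ (∀ i, B.mulVec (v i) = μ i • v i) ∧
      (∀ x, x = ∑ i, (v i ⬝ᵥ x) • v i) ∧ ∑ i, μ i = 0 ∧ μ ≠ 0 := by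
  refine ⟨fun i => (hB.eigenvectorBasis i).ofLp, hB.eigenvalues, fun i j => ?_,
    hB.mulVec_eigenvectorBasis, fun x => ?_, ?_, ?_⟩
  · have := orthonormal_iff_ite.mp hB.eigenvectorBasis.orthonormal i j
    rw [EuclideanSpace.inner_eq_star_dotProduct] at this
    rw [dotProduct_comm]
    simpa using this
  · have := congrArg WithLp.ofLp (hB.eigenvectorBasis.sum_repr' (WithLp.toLp 2 x))
    simp only [EuclideanSpace.inner_eq_star_dotProduct, star_trivial, WithLp.ofLp_sum,
      WithLp.ofLp_smul] at this
    simpa only [dotProduct_comm x] using this.symm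
  · simpa [htr] using hB.trace_eq_sum_eigenvalues.symm
  · exact fun h => hB0 (hB.eigenvalues_eq_zero_iff.mp h)

section Eigenbasis

variable {v : Fin 3 → Fin 3 → ℝ} {μ : Fin 3 → ℝ} {B : Matrix (Fin 3) (Fin 3) ℝ}

lemma coeff_eq_zero (hB : B.IsHermitian) (hv : ∀ i, B.mulVec (v i) = μ i • v i)
    {x : Fin 3 → ℝ} {r : ℝ} (hx : B.mulVec x = r • x) {i : Fin 3} (hi : μ i ≠ r) :
    v i ⬝ᵥ x = 0 := by
  have h := dot_mulVec_comm hB (v i) x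
  rw [hx, hv, dotProduct_smul, dotProduct_smul, dotProduct_comm x, smul_eq_mul, smul_eq_mul] at h
  by_contra h0
  exact hi (mul_right_cancel₀ h0 h.symm)

lemma exists_eigenvalue_eq (hB : B.IsHermitian) (hv : ∀ i, B.mulVec (v i) = μ i • v i)
    (hsum : ∀ x, x = ∑ i, (v i ⬝ᵥ x) • v i) {x : Fin 3 → ℝ} {r : ℝ} (hx0 : x ≠ 0)
    (hx : B.mulVec x = r • x) : ∃ i, μ i = r := by
  by_contra! hr
  refine hx0 ?_
  rw [hsum x]
  exact Finset.sum_eq_zero fun i _ => by rw [coeff_eq_zero hB hv hx (hr i), zero_smul]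

lemma eq_smul_of_injective (hB : B.IsHermitian) (hv : ∀ i, B.mulVec (v i) = μ i • v i)
    (hsum : ∀ x, x = ∑ i, (v i ⬝ᵥ x) • v i) (hμ : Function.Injective μ) {x : Fin 3 → ℝ}
    {i : Fin 3} (hx : B.mulVec x = μ i • x) : x = (v i ⬝ᵥ x) • v i := by
  conv_lhs => rw [hsum x]
  refine Finset.sum_eq_single i (fun j _ hj => ?_) (by simp)
  rw [coeff_eq_zero hB hv hx (hμ.ne hj), zero_smul]

lemma cSpectrum_eq_image {WL : V6 →ₗ[ℝ] V6} (hB : B.IsHermitian) (hWL : HasBlockForm WL B)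
    (hon : ∀ i j, v i ⬝ᵥ v j = if i = j then 1 else 0) (hv : ∀ i, B.mulVec (v i) = μ i • v i)
    (hsum : ∀ x, x = ∑ i, (v i ⬝ᵥ x) • v i) :
    cSpectrum WL = (fun r : ℝ => ((0 : ℝ), -r)) '' Set.range μ := by
  ext ⟨a, b⟩
  rw [mem_cSpectrum_iff hB hWL]
  constructor
  · rintro ⟨rfl, x, hx0, hx⟩
    obtain ⟨i, hi⟩ := exists_eigenvalue_eq hB hv hsum hx0 hx
    exact ⟨μ i, ⟨i, rfl⟩, by simp [hi]⟩
  · rintro ⟨_, ⟨i, rfl⟩, h⟩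
    simp only [Prod.mk.injEq] at h
    refine ⟨h.1.symm, v i, fun h0 => ?_, by rw [hv, ← h.2, neg_neg]⟩
    have := hon i i
    simp [h0] at this

lemma ncard_cSpectrum {WL : V6 →ₗ[ℝ] V6} (hB : B.IsHermitian) (hWL : HasBlockForm WL B)
    (hon : ∀ i j, v i ⬝ᵥ v j = if i = j then 1 else 0) (hv : ∀ i, B.mulVec (v i) = μ i • v i)
    (hsum : ∀ x, x = ∑ i, (v i ⬝ᵥ x) • v i) :
    (cSpectrum WL).ncard = (Set.range μ).ncard := by
  rw [cSpectrum_eq_image hB hWL hon hv hsum]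
  exact Set.ncard_image_of_injective _ fun a b h => neg_injective (Prod.mk.inj h).2

lemma criticalSet_eq_range {WL : V6 →ₗ[ℝ] V6} (hB : B.IsHermitian) (hWL : HasBlockForm WL B)
    (hon : ∀ i j, v i ⬝ᵥ v j = if i = j then 1 else 0) (hv : ∀ i, B.mulVec (v i) = μ i • v i)
    (hsum : ∀ x, x = ∑ i, (v i ⬝ᵥ x) • v i) (hμ : Function.Injective μ) :
    {P : V6 | IsSpacelikeCritical WL P} =
      Set.range fun q : Fin 3 × ℤˣ => join 0 (((q.2 : ℤ) : ℝ) • v q.1) := by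
  ext P
  rw [Set.mem_ofPred_eq, isSpacelikeCritical_iff hB hWL]
  constructor
  · rintro ⟨h1, h2, r, hx, hy⟩
    have hxx : 0 ≤ tl P ⬝ᵥ tl P := by
      simpa using dotProduct_star_self_nonneg (tl P)
    have hy0 : sl P ≠ 0 := fun h => by
      rw [h, dotProduct_zero] at h1
      linarith
    obtain ⟨i, rfl⟩ := exists_eigenvalue_eq hB hv hsum hy0 hy
    have hxi := eq_smul_of_injective hB hv hsum hμ hx
    have hyi := eq_smul_of_injective hB hv hsum hμ hy
    generalize v i ⬝ᵥ tl P = s at hxi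
    generalize v i ⬝ᵥ sl P = t at hyi
    rw [hxi, hyi] at h1 h2
    simp only [dotProduct_smul, smul_dotProduct, hon, if_true, smul_eq_mul, mul_one] at h1 h2
    have ht : t ≠ 0 := fun h => by
      rw [h] at h1
      nlinarith
    have hs : s = 0 := by
      rcases mul_eq_zero.mp h2 with h | h <;> first | exact h | exact absurd h ht
    subst hs
    have ht1 : t = 1 ∨ t = -1 := mul_self_eq_one_iff.mp (by linarith)
    rcases ht1 with rfl | rfl
    · exact ⟨(i, 1), bivector_ext (by simp [hxi]) (by rw [hyi]; simp)⟩
    · exact ⟨(i, -1), bivector_ext (by simp [hxi]) (by rw [hyi]; simp)⟩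
  · rintro ⟨⟨i, s⟩, rfl⟩
    have hs : ((s : ℤ) : ℝ) * ((s : ℤ) : ℝ) = 1 := by
      rcases Int.units_eq_one_or s with rfl | rfl <;> simp
    refine ⟨by simp [hon, hs], by simp, μ i, by simp, ?_⟩
    simp only [sl_join]
    rw [Matrix.mulVec_smul, hv, smul_comm]

lemma criticalSet_finite_and_ncard {WL : V6 →ₗ[ℝ] V6} (hB : B.IsHermitian)
    (hWL : HasBlockForm WL B)
    (hon : ∀ i j, v i ⬝ᵥ v j = if i = j then 1 else 0) (hv : ∀ i, B.mulVec (v i) = μ i • v i)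
    (hsum : ∀ x, x = ∑ i, (v i ⬝ᵥ x) • v i) (hμ : Function.Injective μ) :
    {P : V6 | IsSpacelikeCritical WL P}.Finite ∧
      {P : V6 | IsSpacelikeCritical WL P}.ncard = 6 := by
  rw [criticalSet_eq_range hB hWL hon hv hsum hμ]
  refine ⟨Set.finite_range _, ?_⟩
  rw [Set.ncard_range_of_injective]
  · simp [Nat.card_eq_fintype_card]
  · rintro ⟨i, s⟩ ⟨j, t⟩ h
    have h' : ((s : ℤ) : ℝ) • v i = ((t : ℤ) : ℝ) • v j := by simpa using congrArg sl h
    have hd := congrArg (v i ⬝ᵥ ·) h'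
    simp only [dotProduct_smul, hon, if_true, smul_eq_mul, mul_one] at hd
    by_cases hij : i = j
    · subst hij
      simp only [if_true, mul_one, Int.cast_inj, Units.val_inj] at hd
      rw [hd]
    · simp [hij] at hd

lemma criticalSet_infinite {WL : V6 →ₗ[ℝ] V6} (hB : B.IsHermitian) (hWL : HasBlockForm WL B)
    (hon : ∀ i j, v i ⬝ᵥ v j = if i = j then 1 else 0) (hv : ∀ i, B.mulVec (v i) = μ i • v i)
    {i j : Fin 3} (hij : i ≠ j) (hμ : μ i = μ j) :
    {P : V6 | IsSpacelikeCritical WL P}.Infinite := by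
  have hinj : Set.InjOn (fun t : ℝ => join 0 (Real.cos t • v i + Real.sin t • v j))
      (Set.Icc 0 Real.pi) := by
    intro s hs t ht h
    have h' : Real.cos s • v i + Real.sin s • v j = Real.cos t • v i + Real.sin t • v j := by
      simpa using congrArg sl h
    have hd := congrArg (v i ⬝ᵥ ·) h'
    simp [hon, hij] at hd
    exact Real.injOn_cos hs ht hd
  refine ((Set.Icc_infinite Real.pi_pos).image hinj).mono ?_
  rintro _ ⟨t, -, rfl⟩
  rw [Set.mem_ofPred_eq, isSpacelikeCritical_iff hB hWL]
  refine ⟨?_, by simp, μ i, by simp, ?_⟩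
  · simp [hon, hij, hij.symm]
    linarith [Real.cos_sq_add_sin_sq t]
  · simp only [sl_join, Matrix.mulVec_add, Matrix.mulVec_smul, hv, ← hμ, smul_add]
    rw [smul_comm, smul_comm (Real.sin t)]

end Eigenbasis

lemma ncard_range_eq_two {μ : Fin 3 → ℝ} (h0 : ∑ i, μ i = 0) (hne : μ ≠ 0) {i j : Fin 3}
    (hij : i ≠ j) (hμ : μ i = μ j) : (Set.range μ).ncard = 2 := by
  obtain ⟨k, hki, hkj⟩ : ∃ k, k ≠ i ∧ k ≠ j := by
    clear hμ
    decide +revert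
  have hcover : ∀ l, l = i ∨ l = j ∨ l = k := by
    clear hμ hne h0
    decide +revert
  have huniv : (Finset.univ : Finset (Fin 3)) = {i, j, k} := by
    ext l; simpa using hcover l
  rw [huniv, Finset.sum_insert (by simp [hij, hki.symm]), Finset.sum_pair hkj.symm] at h0
  have hrange : Set.range μ = {μ i, μ k} := by
    ext r
    constructor
    · rintro ⟨l, rfl⟩
      rcases hcover l with rfl | rfl | rfl <;> simp [hμ]
    · rintro (rfl | rfl) <;> exact ⟨_, rfl⟩
  rw [hrange, Set.ncard_pair]
  intro hik
  refine hne (funext fun l => ?_)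
  rcases hcover l with rfl | rfl | rfl <;> simp only [Pi.zero_apply] <;> linarith

/-- Theorems `thm:n2` and `thm:onlyI`: for a nonzero Euclidean
Weyl tensor with `W(e₁,·,·,e₁) = 0`, the set of spacelike critical planes has
exactly six elements (three planes with both signs `±P`) or is infinite; it has
exactly six elements iff `𝒲` has three distinct eigenvalues (Type I), and it is
infinite iff `𝒲` has exactly two distinct eigenvalues (Type D). -/
theorem stmt12 (W : Tensor4) (WL : V6 →ₗ[ℝ] V6)
    (hW : IsWeylE W) (hne : W ≠ 0) (hWL : IsLorentzWeylOp W WL)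
    (hT : ∀ x y : V4, tapp W (e 0) x y (e 0) = 0) :
    (({P : V6 | IsSpacelikeCritical WL P}.Finite ∧
        {P : V6 | IsSpacelikeCritical WL P}.ncard = 6) ∨
      {P : V6 | IsSpacelikeCritical WL P}.Infinite) ∧
    (({P : V6 | IsSpacelikeCritical WL P}.Finite ∧
        {P : V6 | IsSpacelikeCritical WL P}.ncard = 6) ↔
      (cSpectrum WL).ncard = 3) ∧
    ({P : V6 | IsSpacelikeCritical WL P}.Infinite ↔
      (cSpectrum WL).ncard = 2) := by
  obtain ⟨B, hB, htr, hB0, hBW⟩ := exists_blockForm hW hne hWL hT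
  obtain ⟨v, μ, hon, hv, hsum, hμ0, hμne⟩ := exists_eigenbasis hB htr hB0
  rw [ncard_cSpectrum hB hBW hon hv hsum]
  by_cases hμ : Function.Injective μ
  · have hcrit := criticalSet_finite_and_ncard hB hBW hon hv hsum hμ
    have hcard : (Set.range μ).ncard = 3 := by
      rw [Set.ncard_range_of_injective hμ, Nat.card_fin]
    have hninf := Set.not_infinite.mpr hcrit.1
    exact ⟨Or.inl hcrit, by simp [hcrit, hcard], by simp [hninf, hcard]⟩
  · obtain ⟨i, j, hij, hne'⟩ : ∃ i j, μ i = μ j ∧ i ≠ j := by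
      simpa [Function.Injective] using hμ
    have hcrit := criticalSet_infinite hB hBW hon hv hne' hij
    have hcard := ncard_range_eq_two hμ0 hμne hne' hij
    exact ⟨Or.inr hcrit, by simp [hcrit.not_finite, hcard], by simp [hcrit, hcard]⟩
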